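/- arXiv:2303.08460 — 2 statements merged into one kernel-verified Lean document; each statement's English description precedes it below -/
import Mathlib

section
/- Let μ be a probability measure on ℝ and let φ_μ(t) = ∫ exp(i t x) dμ(x) denote its characteristic function. Suppose there exist a polynomial P with complex coefficients and ε > 0 such that φ_μ(t) = exp(P(t)) for all real t with |t| < ε. Then P has degree at most 2 and μ is a Gaussian measure, i.e., μ = gaussianReal m v for some m ∈ ℝ and v ≥ 0. -/
open MeasureTheory ProbabilityTheory
open Filter Topology Complex
open scoped Nat

/-- If `Re (p w) ≤ Re (p (i Im w))` for all `w`, then `p` has degree at most `2`. -/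
theorem Polynomial.natDegree_le_two_of_re_eval_le (p : Polynomial ℂ)
    (h : ∀ w : ℂ, (p.eval w).re ≤ (p.eval (w.im * I)).re) : p.natDegree ≤ 2 := by
  by_contra! hn
  set n := p.natDegree
  set a := p.leadingCoeff
  have hp : p ≠ 0 := by rintro rfl; simp [n] at hn
  have ha : a ≠ 0 := Polynomial.leadingCoeff_ne_zero.mpr hp
  have hlim (z : ℂ) :
      Tendsto (fun s : ℝ ↦ (p.eval ((s⁻¹ : ℝ) * z) * (s ^ n : ℝ)).re) (𝓝[>] 0)
        (𝓝 (a * z ^ n).re) := by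
    have hcont : Continuous fun s : ℝ ↦
        (∑ i ∈ Finset.range (n + 1), p.coeff i * z ^ i * (s : ℂ) ^ (n - i)).re := by fun_prop
    have h0 := hcont.tendsto 0
    rw [Finset.sum_eq_single_of_mem n (by simp)] at h0
    · refine (h0.mono_left nhdsWithin_le_nhds).congr' ?_ |>.trans (by simp [a, n])
      filter_upwards [self_mem_nhdsWithin] with s hs
      have hs' : (s : ℂ) ≠ 0 := by exact_mod_cast (ne_of_gt hs)
      rw [Polynomial.eval_eq_sum_range, Finset.sum_mul]
      congr 1
      refine Finset.sum_congr rfl fun i hi ↦ ?_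
      have hi' : i ≤ n := by simpa [Nat.lt_succ_iff] using hi
      push_cast
      rw [← pow_sub_mul_pow (s : ℂ) hi', mul_pow, inv_pow]
      field_simp
    · intro i hi hin
      have : i < n := lt_of_le_of_ne (by simpa [Nat.lt_succ_iff] using hi) hin
      simp [Nat.sub_ne_zero_of_lt this]
  have hlead (w : ℂ) : (a * w ^ n).re ≤ (a * (w.im * I) ^ n).re := by
    refine le_of_tendsto_of_tendsto (hlim w) (hlim (w.im * I)) ?_
    filter_upwards [self_mem_nhdsWithin] with s hs
    have hs : 0 < s := hs
    rw [re_mul_ofReal, re_mul_ofReal]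
    have := h ((s⁻¹ : ℝ) * w)
    rw [im_ofReal_mul, ofReal_mul, mul_assoc] at this
    gcongr
  have hre (w : ℂ) (hw : w ^ n = starRingEnd ℂ a) : w.re = 0 := by
    have h1 := hlead w
    rw [hw, mul_conj, ofReal_re, normSq_eq_norm_sq] at h1
    have hwn : ‖w‖ ^ n = ‖a‖ := by rw [← norm_pow, hw, norm_conj]
    have h2 : ‖a‖ ^ 2 ≤ ‖a‖ * |w.im| ^ n := by
      refine h1.trans ((re_le_norm _).trans_eq ?_)
      simp
    have ha' : 0 < ‖a‖ := norm_pos_iff.mpr ha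
    have h3 : ‖w‖ ^ n ≤ |w.im| ^ n := by
      rw [hwn]; exact le_of_mul_le_mul_left (by linarith [sq ‖a‖]) ha'
    have h4 : ‖w‖ ≤ |w.im| := le_of_pow_le_pow_left₀ (by omega) (abs_nonneg _) h3
    have h5 : ‖w‖ ^ 2 ≤ w.im ^ 2 := by
      rw [← sq_abs w.im]; gcongr
    rw [← normSq_eq_norm_sq, normSq_apply] at h5
    nlinarith [sq_nonneg w.re]
  obtain ⟨w, hw⟩ := IsAlgClosed.exists_pow_nat_eq (starRingEnd ℂ a) (show 0 < n by omega)
  set ζ := exp (2 * Real.pi * I / n) with hζ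
  have hζn : ζ ^ n = 1 := (Complex.isPrimitiveRoot_exp n (by omega)).pow_eq_one
  have hw0 : w ≠ 0 := by
    rintro rfl
    rw [zero_pow (by omega)] at hw
    exact ha ((map_eq_zero _).1 hw.symm)
  have h1 := hre w hw
  have h2 := hre (w * ζ) (by rw [mul_pow, hζn, mul_one, hw])
  rw [mul_re, h1, zero_mul, zero_sub, neg_eq_zero, mul_eq_zero] at h2
  rcases h2 with h2 | h2
  · exact hw0 (Complex.ext h1 h2)
  · have : ζ = exp ((2 * Real.pi / n : ℝ) * I) := by rw [hζ]; push_cast; ring_nf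
    rw [this, exp_ofReal_mul_I_im] at h2
    have hn' : (3 : ℝ) ≤ n := by exact_mod_cast hn
    refine (Real.sin_pos_of_pos_of_lt_pi (by positivity) ?_).ne' h2
    rw [div_lt_iff₀ (by positivity)]
    nlinarith [Real.pi_pos]

/-- If `charFun μ` is the exponential of a polynomial of degree at most `2`, `μ` is Gaussian. -/
theorem exists_eq_gaussianReal_of_charFun_eq (μ : Measure ℝ) [IsProbabilityMeasure μ]
    (p : Polynomial ℂ) (hp : p.natDegree ≤ 2) (h : ∀ t : ℝ, charFun μ t = exp (p.eval (t : ℂ))) :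
    ∃ (m : ℝ) (v : NNReal), μ = gaussianReal m v := by
  set c := p.coeff 0
  set b := p.coeff 1
  set a := p.coeff 2
  have heval (t : ℝ) : p.eval (t : ℂ) = c + b * t + a * t ^ 2 := by
    rw [Polynomial.eval_eq_sum_range' (n := 3) (by omega)]
    simp [Finset.sum_range_succ, a, b, c]
  have hc : exp c = 1 := by
    have := h 0
    rw [heval] at this
    simpa using this.symm
  have hφ (t : ℝ) : charFun μ t = exp (b * t + a * t ^ 2) := by
    rw [h, heval, add_assoc, exp_add, hc, one_mul]
  have hre (t : ℝ) : b.re * t + a.re * t ^ 2 ≤ 0 := by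
    have h1 := norm_charFun_le_one (μ := μ) t
    rw [hφ, norm_exp, Real.exp_le_one_iff] at h1
    simpa [← ofReal_pow] using h1
  have hb : b.re = 0 := by
    have h1 := hre (b.re / (1 + |a.re|))
    have h2 : b.re * (b.re / (1 + |a.re|)) + a.re * (b.re / (1 + |a.re|)) ^ 2 =
      b.re ^ 2 * ((1 + |a.re| + a.re) / (1 + |a.re|) ^ 2) := by
      field_simp
    rw [h2] at h1
    have h3 : 0 < (1 + |a.re| + a.re) / (1 + |a.re|) ^ 2 := by
      have := neg_abs_le a.re
      apply div_pos <;> first | positivity | linarith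
    have h4 : b.re ^ 2 ≤ 0 := by nlinarith
    exact pow_eq_zero_iff two_ne_zero |>.1 (le_antisymm h4 (sq_nonneg _))
  have ha : a.re ≤ 0 := by simpa [hb] using hre 1
  have hb' : b = b.im * I := by apply Complex.ext <;> simp [hb]
  have him (t : ℝ) : exp (2 * a.im * t ^ 2 * I) = 1 := by
    have h1 := charFun_neg (μ := μ) t
    rw [hφ, hφ, ← exp_conj] at h1
    have h2 : b * (-t : ℝ) + a * (-t : ℝ) ^ 2 =
        starRingEnd ℂ (b * t + a * t ^ 2) + 2 * a.im * t ^ 2 * I := by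
      apply Complex.ext <;> (simp [← ofReal_pow, hb]; try ring)
    rw [h2, exp_add] at h1
    exact (mul_eq_left₀ (exp_ne_zero _)).1 h1
  have ha' : a.im = 0 := by
    by_contra hne
    have h1 := him (√(Real.pi / (2 * |a.im|)))
    rw [← ofReal_pow, Real.sq_sqrt (by positivity)] at h1
    rcases abs_choice a.im with h2 | h2
    · have h3 : (2 * a.im * ((Real.pi / (2 * |a.im|) : ℝ) : ℂ) * I) = Real.pi * I := by
        rw [h2]; push_cast
        have : (a.im : ℂ) ≠ 0 := by exact_mod_cast hne
        field_simp
      rw [h3, exp_pi_mul_I] at h1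
      norm_num at h1
    · have h3 : (2 * a.im * ((Real.pi / (2 * |a.im|) : ℝ) : ℂ) * I) = -(Real.pi * I) := by
        rw [h2]; push_cast
        have : (a.im : ℂ) ≠ 0 := by exact_mod_cast hne
        field_simp
      rw [h3, exp_neg, exp_pi_mul_I] at h1
      norm_num at h1
  obtain ⟨v, hv⟩ : ∃ v : NNReal, (v : ℝ) = -2 * a.re :=
    ⟨(-2 * a.re).toNNReal, Real.coe_toNNReal _ (by linarith)⟩
  have hv' : (v : ℂ) = -2 * a.re := by exact_mod_cast congrArg ofReal hv
  refine ⟨b.im, v, Measure.ext_of_charFun (funext fun t ↦ ?_)⟩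
  rw [hφ, charFun_gaussianReal]
  congr 1
  have ha'' : a = a.re := by apply Complex.ext <;> simp [ha']
  rw [hv', hb', ha'']
  simp
  ring

/-- The restriction to `ℝ` of an entire function has the expected iterated derivatives. -/
theorem Differentiable.iteratedDeriv_comp_ofReal {E : ℂ → ℂ} (hE : Differentiable ℂ E) (n : ℕ) :
    iteratedDeriv n (fun t : ℝ ↦ E t) = fun t : ℝ ↦ iteratedDeriv n E t := by
  induction n with
  | zero => simp
  | succ n ih =>
    ext t
    rw [iteratedDeriv_succ, ih, iteratedDeriv_succ]
    exact ((hE.contDiff (n := ⊤)).differentiable_iteratedDeriv n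
      (by simp) _).hasDerivAt.comp_ofReal.deriv

/-- The symmetric second difference of an entire function at the origin is `O(t ^ 2)`. -/
theorem Differentiable.isBigO_symmetric_second_difference {G : ℂ → ℂ} (hG : Differentiable ℂ G) :
    (fun t : ℂ ↦ 2 * G 0 - G t - G (-t)) =O[𝓝 0] fun t ↦ ‖t‖ ^ 2 := by
  obtain ⟨q, hq⟩ := hG.analyticAt 0
  have h1 := hq.isBigO_sub_partialSum_pow 2
  have hneg : Tendsto (fun t : ℂ ↦ -t) (𝓝 0) (𝓝 0) := by
    simpa using (continuous_neg (G := ℂ)).tendsto 0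
  have h2 := h1.comp_tendsto hneg
  simp only [Function.comp_def, norm_neg] at h2
  refine (h1.add h2).neg_left.congr_left fun t ↦ ?_
  simp only [FormalMultilinearSeries.partialSum, Finset.sum_range_succ, Finset.sum_range_zero,
    hq.coeff_zero, zero_add]
  have h3 : q 1 (fun _ ↦ -t) = - q 1 (fun _ ↦ t) := by simp
  rw [h3]
  ring

/-- Finiteness of an even moment is membership in the corresponding `L^p` space. -/
theorem memLp_id_of_integrable_even_pow {μ : Measure ℝ} [IsFiniteMeasure μ] {k : ℕ}
    (h : Integrable (fun x : ℝ ↦ x ^ (2 * k)) μ) : MemLp id (2 * k : ℕ) μ := by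
  rcases Nat.eq_zero_or_pos k with rfl | hk
  · simpa using aestronglyMeasurable_id
  · rw [← integrable_norm_rpow_iff aestronglyMeasurable_id (by simp [hk.ne'])
      (ENNReal.natCast_ne_top _)]
    refine h.congr (.of_forall fun x ↦ ?_)
    simp only [ENNReal.toReal_natCast, Real.rpow_natCast, id, Real.norm_eq_abs]
    exact ((even_two_mul k).pow_abs x).symm

/-- If the characteristic function agrees near `0` with an entire function, its derivatives of even
order are given by the even moments. -/
theorem eventually_integral_pow_mul_exp_eq {μ : Measure ℝ} [IsFiniteMeasure μ] {E : ℂ → ℂ}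
    (hE : Differentiable ℂ E) (h : ∀ᶠ t : ℝ in 𝓝 0, charFun μ t = E t) {k : ℕ}
    (hk : Integrable (fun x : ℝ ↦ x ^ (2 * k)) μ) :
    ∀ᶠ t : ℝ in 𝓝 0, ∫ x : ℝ, (x : ℂ) ^ (2 * k) * exp (t * x * I) ∂μ =
      (-1) ^ k * iteratedDeriv (2 * k) E t := by
  have h1 := Filter.EventuallyEq.iteratedDeriv (f₁ := charFun μ) (f₂ := fun t : ℝ ↦ E t) h (2 * k)
  filter_upwards [h1] with t ht
  rw [iteratedDeriv_charFun (memLp_id_of_integrable_even_pow hk), hE.iteratedDeriv_comp_ofReal,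
    pow_mul, I_sq] at ht
  beta_reduce at ht
  rw [← ht, ← mul_assoc, ← mul_pow]
  simp

/-- If the characteristic function agrees near `0` with an entire function, all even moments are
finite. -/
theorem integrable_even_pow_of_charFun_eventuallyEq {μ : Measure ℝ} [IsFiniteMeasure μ] {E : ℂ → ℂ}
    (hE : Differentiable ℂ E) (h : ∀ᶠ t : ℝ in 𝓝 0, charFun μ t = E t) (k : ℕ) :
    Integrable (fun x : ℝ ↦ x ^ (2 * k)) μ := by
  induction k with
  | zero => simp
  | succ k ih =>
    set G := iteratedDeriv (2 * k) E
    have hG : Differentiable ℂ G :=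
      (hE.contDiff (n := ⊤)).differentiable_iteratedDeriv _ (WithTop.coe_lt_top _)
    have hint := eventually_integral_pow_mul_exp_eq hE h ih
    obtain ⟨C, hC⟩ := hG.isBigO_symmetric_second_difference.bound
    have hC' : ∀ᶠ t : ℝ in 𝓝 0, ‖2 * G 0 - G t - G (-t)‖ ≤ C * t ^ 2 := by
      have := (continuous_ofReal.tendsto 0).eventually hC
      filter_upwards [this] with t ht
      simpa using ht
    have hneg : Tendsto (fun t : ℝ ↦ -t) (𝓝 0) (𝓝 0) := by
      simpa using (continuous_neg (G := ℝ)).tendsto 0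
    set F : ℝ → ℝ → ℝ := fun t x ↦ x ^ (2 * k) * (2 * Real.sin (t * x / 2) / t) ^ 2 with hF
    have hbound : ∀ᶠ t : ℝ in 𝓝[≠] 0, ∫⁻ x, ‖F t x‖ₑ ∂μ ≤ ENNReal.ofReal C := by
      filter_upwards [nhdsWithin_le_nhds hint, nhdsWithin_le_nhds (hneg.eventually hint),
        nhdsWithin_le_nhds hC', self_mem_nhdsWithin] with t h1 h2 h3 ht
      have ht : t ≠ 0 := ht
      have h0 := hint.self_of_nhds
      have hnn (x : ℝ) : 0 ≤ F t x := by
        have := (even_two_mul k).pow_nonneg x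
        positivity
      have hi (s : ℝ) : Integrable (fun x : ℝ ↦ (x : ℂ) ^ (2 * k) * exp (s * x * I)) μ := by
        refine (ih.ofReal (𝕜 := ℂ)).mono (by fun_prop) (.of_forall fun x ↦ ?_)
        have : ‖exp (s * x * I)‖ = 1 := by
          rw [← ofReal_mul, norm_exp_ofReal_mul_I]
        simp [this]
      have hi' : Integrable (fun x : ℝ ↦ 2 * ((x : ℂ) ^ (2 * k) * exp ((0 : ℝ) * x * I)) -
          (x : ℂ) ^ (2 * k) * exp (t * x * I)) μ := ((hi 0).const_mul 2).sub (hi t)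
      have hFx (x : ℝ) : (F t x : ℂ) = (2 * ((x : ℂ) ^ (2 * k) * exp ((0 : ℝ) * x * I)) -
          (x : ℂ) ^ (2 * k) * exp (t * x * I) -
            (x : ℂ) ^ (2 * k) * exp ((-t : ℝ) * x * I)) / (t : ℂ) ^ 2 := by
        have e1 : exp ((-t : ℝ) * x * I) = exp (-(t * x) * I) := by push_cast; ring_nf
        have e2 : exp (t * x * I) + exp (-(t * x) * I) = 2 * Complex.cos (t * x) := by
          rw [Complex.cos]; ring
        have e3 : Complex.cos (t * x) = 1 - 2 * Complex.sin (t * x / 2) ^ 2 := by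
          rw [Complex.sin_sq, ← mul_div_cancel₀ (t * x : ℂ) (two_ne_zero' ℂ), Complex.cos_two_mul]
          ring_nf
        rw [e1]
        have e4 : exp (-(t * x) * I) =
            2 * (1 - 2 * Complex.sin (t * x / 2) ^ 2) - exp (t * x * I) := by
          rw [← e3, ← e2]; ring
        rw [e4, hF]
        push_cast
        simp only [zero_mul, exp_zero]
        ring
      have hFi : Integrable (fun x ↦ (F t x : ℂ)) μ := by
        simp_rw [hFx]
        exact (hi'.sub (hi (-t))).div_const _
      have hFint : ((∫ x, F t x ∂μ : ℝ) : ℂ) =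
          (-1) ^ k * (2 * G 0 - G t - G (-t)) / (t : ℂ) ^ 2 := by
        rw [← integral_complex_ofReal]
        simp_rw [hFx]
        rw [integral_div, integral_sub hi' (hi (-t)),
          integral_sub ((hi 0).const_mul 2) (hi t), integral_const_mul, h0, h1, h2]
        push_cast
        ring
      have hFi' : Integrable (F t) μ := by simpa using hFi.re
      calc ∫⁻ x, ‖F t x‖ₑ ∂μ = ENNReal.ofReal (∫ x, F t x ∂μ) := by
            rw [ofReal_integral_eq_lintegral_ofReal hFi' (.of_forall hnn)]
            exact lintegral_congr fun x ↦ Real.enorm_of_nonneg (hnn x)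
        _ ≤ ENNReal.ofReal C := by
            refine ENNReal.ofReal_le_ofReal ((le_abs_self _).trans ?_)
            rw [← Real.norm_eq_abs, ← Complex.norm_real, hFint]
            simp only [norm_div, norm_mul, norm_pow, norm_neg, norm_one, one_pow, one_mul, norm_real,
              Real.norm_eq_abs, sq_abs]
            rwa [div_le_iff₀ (by positivity)]
    have hseq : Tendsto (fun n : ℕ ↦ 1 / ((n : ℝ) + 1)) atTop (𝓝[≠] 0) :=
      tendsto_nhdsWithin_iff.2 ⟨tendsto_one_div_add_atTop_nhds_zero_nat,
        .of_forall fun n ↦ (Nat.one_div_pos_of_nat).ne'⟩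
    refine integrable_of_tendsto (G := fun n : ℕ ↦ F (1 / ((n : ℝ) + 1))) (.of_forall fun x ↦ ?_)
      (fun n ↦ by fun_prop) (ne_top_of_le_ne_top (ENNReal.ofReal_ne_top (r := C))
        (liminf_le_of_frequently_le' (hseq.eventually hbound).frequently))
    refine Tendsto.comp (y := 𝓝[≠] 0) (g := fun t ↦ F t x) ?_ hseq
    have hd : HasDerivAt (fun t : ℝ ↦ 2 * Real.sin (t * x / 2)) x 0 := by
      have := ((((hasDerivAt_id (0 : ℝ)).mul_const x).div_const 2).sin).const_mul 2
      convert! this using 1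
      simp [mul_div_cancel₀]
    have := (hd.tendsto_slope_zero.pow 2).const_mul (x ^ (2 * k))
    rw [← pow_add, ← Nat.mul_succ] at this
    refine this.congr fun t ↦ ?_
    simp [hF, div_eq_inv_mul]

/-- If the characteristic function agrees near `0` with an entire function, all exponential moments
are finite. -/
theorem integrable_exp_mul_of_charFun_eventuallyEq {μ : Measure ℝ} [IsFiniteMeasure μ] {E : ℂ → ℂ}
    (hE : Differentiable ℂ E) (h : ∀ᶠ t : ℝ in 𝓝 0, charFun μ t = E t) (r : ℝ) :
    Integrable (fun x : ℝ ↦ Real.exp (r * x)) μ := by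
  have hpow := integrable_even_pow_of_charFun_eventuallyEq hE h
  have hmom (k : ℕ) : ((∫ x : ℝ, x ^ (2 * k) ∂μ : ℝ) : ℂ) =
      (-1) ^ k * iteratedDeriv (2 * k) E 0 := by
    have := (eventually_integral_pow_mul_exp_eq hE h (hpow k)).self_of_nhds
    rw [← integral_complex_ofReal]
    simpa using this
  have hnn (k : ℕ) (x : ℝ) : 0 ≤ (r * x) ^ (2 * k) / (2 * k)! := by
    have := (even_two_mul k).pow_nonneg (r * x)
    positivity
  have hsum : Summable fun k : ℕ ↦ ∫ x, (r * x) ^ (2 * k) / (2 * k)! ∂μ := by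
    have h1 := (hasSum_taylorSeries_of_entire hE 0 r).summable.norm
    refine (h1.comp_injective (mul_right_injective₀ (two_ne_zero' ℕ))).congr fun k ↦ ?_
    have h2 : ‖iteratedDeriv (2 * k) E 0‖ = ∫ x : ℝ, x ^ (2 * k) ∂μ := by
      have : 0 ≤ ∫ x : ℝ, x ^ (2 * k) ∂μ :=
        integral_nonneg fun x ↦ (even_two_mul k).pow_nonneg x
      rw [← abs_of_nonneg this, ← Real.norm_eq_abs, ← norm_real, hmom]
      simp
    simp only [Function.comp_apply, norm_smul, h2, mul_pow, mul_div_right_comm]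
    rw [integral_const_mul]
    simp [pow_mul]
    ring
  have hcosh : Integrable (fun x ↦ Real.cosh (r * x)) μ := by
    refine ⟨by fun_prop, ?_⟩
    have h1 (x : ℝ) : ‖Real.cosh (r * x)‖ₑ =
        ∑' k : ℕ, ENNReal.ofReal ((r * x) ^ (2 * k) / (2 * k)!) := by
      rw [Real.enorm_of_nonneg (Real.cosh_pos _).le, Real.cosh_eq_tsum,
        ENNReal.ofReal_tsum_of_nonneg (hnn · x) (Real.hasSum_cosh _).summable]
    have hi (k : ℕ) : Integrable (fun x ↦ (r * x) ^ (2 * k) / (2 * k)!) μ := by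
      simp_rw [mul_pow]
      exact ((hpow k).const_mul _).div_const _
    rw [HasFiniteIntegral]
    simp_rw [h1]
    rw [lintegral_tsum fun k ↦ by fun_prop]
    simp_rw [← ofReal_integral_eq_lintegral_ofReal (hi _) (.of_forall (hnn _))]
    exact hsum.tsum_ofReal_lt_top
  refine (hcosh.const_mul 2).mono (by fun_prop) (.of_forall fun x ↦ ?_)
  rw [Real.norm_of_nonneg (Real.exp_pos _).le, Real.norm_of_nonneg (by positivity), Real.cosh_eq]
  have := Real.exp_pos (-(r * x))
  linarith

/-- If the characteristic function agrees near `0` with an entire function `E`, then the complex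
moment generating function satisfies `complexMGF id μ (z * I) = E z`. -/
theorem complexMGF_mul_I_of_charFun_eventuallyEq {μ : Measure ℝ} [IsFiniteMeasure μ] {E : ℂ → ℂ}
    (hE : Differentiable ℂ E) (h : ∀ᶠ t : ℝ in 𝓝 0, charFun μ t = E t) (z : ℂ) :
    complexMGF id μ (z * I) = E z := by
  have huniv : integrableExpSet id μ = Set.univ :=
    Set.eq_univ_of_forall (integrable_exp_mul_of_charFun_eventuallyEq hE h)
  have hM : Differentiable ℂ (complexMGF id μ) := fun z ↦
    (analyticAt_complexMGF (by simp [huniv])).differentiableAt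
  have hM' : Differentiable ℂ fun z ↦ complexMGF id μ (z * I) := hM.comp (by fun_prop)
  have hofReal : Tendsto (fun t : ℝ ↦ (t : ℂ)) (𝓝[≠] 0) (𝓝[≠] 0) :=
    tendsto_nhdsWithin_iff.2 ⟨(continuous_ofReal.tendsto' 0 0 rfl).mono_left nhdsWithin_le_nhds,
      by filter_upwards [self_mem_nhdsWithin] with t ht using by simpa using ht⟩
  refine congrFun (AnalyticOnNhd.eq_of_frequently_eq (z₀ := 0) (fun z _ ↦ hM'.analyticAt z)
    (fun z _ ↦ hE.analyticAt z) (hofReal.frequently ?_)) z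
  refine Eventually.frequently ?_
  filter_upwards [nhdsWithin_le_nhds h] with t ht
  rw [complexMGF_id_mul_I, ht]

/-- Marcinkiewicz (1939): if the characteristic function of a probability measure `μ` on ℝ
equals `exp (p t)` for a polynomial `p` on a neighbourhood of the origin, then `p` has degree
at most 2 and `μ` is a Gaussian measure. -/
theorem marcinkiewicz_polynomial_log_charFun
    (μ : Measure ℝ) [IsProbabilityMeasure μ] (p : Polynomial ℂ) (ε : ℝ) (hε : 0 < ε)
    (h : ∀ t : ℝ, |t| < ε →
      ∫ x, Complex.exp (t * x * Complex.I) ∂μ = Complex.exp (p.eval (t : ℂ))) :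
    p.degree ≤ 2 ∧ ∃ (m : ℝ) (v : NNReal), μ = gaussianReal m v := by
  have hE : Differentiable ℂ fun z ↦ exp (p.eval z) := p.differentiable.cexp
  have hφ : ∀ᶠ t : ℝ in 𝓝 0, charFun μ t = exp (p.eval (t : ℂ)) := by
    filter_upwards [Metric.ball_mem_nhds 0 hε] with t ht
    rw [charFun_apply_real, h t (by simpa using ht)]
  have hM := complexMGF_mul_I_of_charFun_eventuallyEq hE hφ
  have hdeg : p.natDegree ≤ 2 := by
    refine p.natDegree_le_two_of_re_eval_le fun w ↦ Real.exp_le_exp.1 ?_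
    rw [← norm_exp, ← norm_exp, ← hM, ← hM]
    refine norm_complexMGF_le_mgf.trans ?_
    have : (w.im * I : ℂ) * I = ((w * I).re : ℝ) := by simp [mul_assoc]
    rw [this, complexMGF_ofReal, norm_real]
    exact le_abs_self _
  refine ⟨Polynomial.natDegree_le_iff_degree_le.1 hdeg,
    exists_eq_gaussianReal_of_charFun_eq μ p hdeg fun t ↦ ?_⟩
  rw [← complexMGF_id_mul_I, hM]
end

section
/- For every real number a with a ≠ 0 and a ≠ 1, the 4 × 4 real matrix with rows (1, 1 + 2a, a² + 2a, a²), (1, 2, 1, 0), (1, 1, 0, 0), (0, 0, 1, a) is invertible; equivalently, its determinant equals a²(1 − a) ≠ 0. -/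
/-- The 4 × 4 coefficient matrix arising in the proof of the identification theorem is
invertible for `a ∉ {0, 1}`: its determinant equals `a² (1 - a) ≠ 0`. -/
theorem ed_coefficient_matrix_invertible (a : ℝ) (ha0 : a ≠ 0) (ha1 : a ≠ 1) :
    (!![1, 1 + 2 * a, a ^ 2 + 2 * a, a ^ 2;
        1, 2, 1, 0;
        1, 1, 0, 0;
        0, 0, 1, a] : Matrix (Fin 4) (Fin 4) ℝ).det = a ^ 2 * (1 - a)
    ∧ a ^ 2 * (1 - a) ≠ 0
    ∧ IsUnit (!![1, 1 + 2 * a, a ^ 2 + 2 * a, a ^ 2;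
        1, 2, 1, 0;
        1, 1, 0, 0;
        0, 0, 1, a] : Matrix (Fin 4) (Fin 4) ℝ) := by
  have hdet : (!![1, 1 + 2 * a, a ^ 2 + 2 * a, a ^ 2;
        1, 2, 1, 0;
        1, 1, 0, 0;
        0, 0, 1, a] : Matrix (Fin 4) (Fin 4) ℝ).det = a ^ 2 * (1 - a) := by
    simp [Matrix.det_succ_row_zero, Fin.sum_univ_succ, Fin.succAbove]
    ring
  have hne : a ^ 2 * (1 - a) ≠ 0 :=
    mul_ne_zero (pow_ne_zero 2 ha0) (sub_ne_zero.mpr ha1.symm)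
  refine ⟨hdet, hne, ?_⟩
  rw [Matrix.isUnit_iff_isUnit_det, hdet]
  exact hne.isUnit
end
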